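/- Let G be a free group with free basis a₁, …, aₙ and H a finitely generated free group, let φ, ψ : G → H be homomorphisms, and let u, v ∈ H with u ≠ v. Let φ^v : G → H be given by gφ^v = v⁻¹·(gφ)·v, and let χ = φ^v * ψ : G*G → H be the homomorphism on the free group G*G with basis a₁,…,aₙ,a₁′,…,aₙ′ sending aᵢ ↦ aᵢφ^v and aᵢ′ ↦ aᵢψ. Suppose χ has remnant, and suppose that for every basis element a of G*G the remnant of a does not fully cancel in the products (aχ)·(v⁻¹u) and (u⁻¹v)·(aχ), i.e. c(aχ, v⁻¹u) < |aχ| − Pχ(a) and c(u⁻¹v, aχ) < |aχ| − Sχ(a). Then u and v are not doubly-twisted conjugate: there is no g ∈ G with v = (gφ)⁻¹·u·(gψ). -/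

import Mathlib

/-- The number of letters cancelled in the product `u * v` of elements of a free group:
`c(u,v) = (|u| + |v| - |uv|)/2`. -/
def cancel {κ : Type*} [DecidableEq κ] (u v : FreeGroup κ) : ℕ :=
  (FreeGroup.norm u + FreeGroup.norm v - FreeGroup.norm (u * v)) / 2

/-- The basis letter indexed by `(i, ε)`: `of i` if `ε = true`, `(of i)⁻¹` if `ε = false`. -/
def bLetter {ι : Type*} (p : ι × Bool) : FreeGroup ι :=
  cond p.2 (FreeGroup.of p.1) (FreeGroup.of p.1)⁻¹

/-- `P_χ(x_i)`: maximal cancellation of `x_iχ` with the image of a basis letter `b ≠ x_i⁻¹`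
multiplied on the left. -/
def Pc {ι κ : Type*} [Fintype ι] [DecidableEq ι] [DecidableEq κ]
    (χ : FreeGroup ι →* FreeGroup κ) (i : ι) : ℕ :=
  (Finset.univ.erase (i, false)).sup fun p => cancel (χ (bLetter p)) (χ (FreeGroup.of i))

/-- `S_χ(x_i)`: maximal cancellation of `x_iχ` with the image of a basis letter `b ≠ x_i⁻¹`
multiplied on the right. -/
def Sc {ι κ : Type*} [Fintype ι] [DecidableEq ι] [DecidableEq κ]
    (χ : FreeGroup ι →* FreeGroup κ) (i : ι) : ℕ :=
  (Finset.univ.erase (i, false)).sup fun p => cancel (χ (FreeGroup.of i)) (χ (bLetter p))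

/-- `χ` has remnant if for every basis element a nontrivial subword of its image survives
all the cancellations: `P_χ(x_i) + S_χ(x_i) < |x_iχ|`. -/
def HasRemnant {ι κ : Type*} [Fintype ι] [DecidableEq ι] [DecidableEq κ]
    (χ : FreeGroup ι →* FreeGroup κ) : Prop :=
  ∀ i : ι, Pc χ i + Sc χ i < FreeGroup.norm (χ (FreeGroup.of i))

/-- The remnant length `|Rem_χ(x_i)| = |x_iχ| - P_χ(x_i) - S_χ(x_i)`. -/
def RemLen {ι κ : Type*} [Fintype ι] [DecidableEq ι] [DecidableEq κ]
    (χ : FreeGroup ι →* FreeGroup κ) (i : ι) : ℕ :=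
  FreeGroup.norm (χ (FreeGroup.of i)) - Pc χ i - Sc χ i

/-- The length of the longest common prefix of two lists. -/
def commonPrefixLength {α : Type*} [DecidableEq α] : List α → List α → ℕ
  | a :: l, b :: m => if a = b then commonPrefixLength l m + 1 else 0
  | [], _ => 0
  | _ :: _, [] => 0

theorem commonPrefixLength_self {α : Type*} [DecidableEq α] (l : List α) :
    commonPrefixLength l l = l.length := by
  induction l with
  | nil => simp [commonPrefixLength]
  | cons a l ih => simp [commonPrefixLength, ih]

theorem min_commonPrefixLength_le {α : Type*} [DecidableEq α] (l m r : List α) :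
    min (commonPrefixLength l m) (commonPrefixLength m r) ≤ commonPrefixLength l r := by
  induction l generalizing m r with
  | nil => simp [commonPrefixLength]
  | cons a l ih =>
    rcases m with _ | ⟨b, m⟩
    · simp [commonPrefixLength]
    rcases r with _ | ⟨c, r⟩
    · simp [commonPrefixLength]
    have := ih m r
    simp only [commonPrefixLength]
    split_ifs <;> grind

namespace FreeGroup

theorem IsReduced.norm_mk {α : Type*} [DecidableEq α] {L : List (α × Bool)} (h : IsReduced L) :
    norm (mk L) = L.length := by
  rw [norm, toWord_mk, h.reduce_eq]

theorem IsReduced.invRev {α : Type*} [DecidableEq α] {L : List (α × Bool)} (h : IsReduced L) :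
    IsReduced (FreeGroup.invRev L) := by
  rw [isReduced_iff_reduce_eq, reduce_invRev, h.reduce_eq]

theorem IsReduced.norm_mk_inv_mul_mk {α : Type*} [DecidableEq α] {L M : List (α × Bool)}
    (hL : IsReduced L) (hM : IsReduced M) :
    norm ((mk L)⁻¹ * mk M) + 2 * commonPrefixLength L M = L.length + M.length := by
  induction L generalizing M with
  | nil => simp [commonPrefixLength, ← one_eq_mk, hM.norm_mk]
  | cons a L ih =>
    rcases M with _ | ⟨b, M⟩
    · simp [commonPrefixLength, ← one_eq_mk, -inv_mk, norm_inv_eq, hL.norm_mk]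
    by_cases hab : a = b
    · subst hab
      have h : (mk (a :: L))⁻¹ * mk (a :: M) = (mk L)⁻¹ * mk M := by
        rw [← List.singleton_append, ← mul_mk, ← List.singleton_append (l := M), ← mul_mk]
        group
      have := ih (hL.infix (List.suffix_cons a L).isInfix)
        (hM.infix (List.suffix_cons a M).isInfix)
      rw [h]
      simp only [commonPrefixLength, if_true, List.length_cons]
      omega
    · have h : IsReduced (FreeGroup.invRev (a :: L) ++ b :: M) := by
        refine List.isChain_append.2 ⟨hL.invRev, hM, ?_⟩
        simp only [FreeGroup.invRev, List.map_cons, List.reverse_cons, List.getLast?_concat,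
          List.head?_cons, Option.mem_def, Option.some.injEq]
        rintro _ rfl _ rfl h1
        by_contra h2
        exact hab (Prod.ext h1 (by simpa using h2))
      rw [inv_mk, mul_mk, h.norm_mk]
      simp [commonPrefixLength, hab]

theorem norm_inv_mul_add {α : Type*} [DecidableEq α] (p q : FreeGroup α) :
    norm (p⁻¹ * q) + 2 * commonPrefixLength p.toWord q.toWord = norm p + norm q := by
  simpa only [mk_toWord, norm] using
    (isReduced_toWord (x := p)).norm_mk_inv_mul_mk (isReduced_toWord (x := q))

end FreeGroup

open FreeGroup hiding map_mul map_inv map_one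

theorem norm_mul_add_two_mul_cancel {α : Type*} [DecidableEq α] (p q : FreeGroup α) :
    norm (p * q) + 2 * cancel p q = norm p + norm q := by
  have := norm_inv_mul_add p⁻¹ q
  rw [inv_inv, norm_inv_eq] at this
  unfold cancel
  omega

theorem cancel_inv_eq_commonPrefixLength {α : Type*} [DecidableEq α] (p q : FreeGroup α) :
    cancel p⁻¹ q = commonPrefixLength p.toWord q.toWord := by
  have h1 := norm_inv_mul_add p q
  have h2 := norm_mul_add_two_mul_cancel p⁻¹ q
  rw [norm_inv_eq] at h2
  omega

theorem min_cancel_le {α : Type*} [DecidableEq α] (p q r : FreeGroup α) :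
    min (cancel p r) (cancel r⁻¹ q) ≤ cancel p q := by
  have := min_commonPrefixLength_le p⁻¹.toWord r.toWord q.toWord
  simpa only [← cancel_inv_eq_commonPrefixLength, inv_inv] using this

theorem cancel_inv_inv {α : Type*} [DecidableEq α] (p q : FreeGroup α) :
    cancel q⁻¹ p⁻¹ = cancel p q := by
  rw [cancel, cancel, ← mul_inv_rev, norm_inv_eq, norm_inv_eq, norm_inv_eq, add_comm]

theorem cancel_inv_self {α : Type*} [DecidableEq α] (p : FreeGroup α) :
    cancel p⁻¹ p = norm p := by
  rw [cancel_inv_eq_commonPrefixLength, commonPrefixLength_self, FreeGroup.norm]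

theorem cancel_inv_mul_add_cancel {α : Type*} [DecidableEq α] (p q : FreeGroup α) :
    cancel p⁻¹ (p * q) + cancel p q = norm p := by
  have h1 := norm_mul_add_two_mul_cancel p q
  have h2 := norm_mul_add_two_mul_cancel p⁻¹ (p * q)
  rw [inv_mul_cancel_left, norm_inv_eq] at h2
  omega

theorem bLetter_inv {ι : Type*} (p : ι × Bool) : (bLetter p)⁻¹ = bLetter (p.1, !p.2) := by
  rcases p with ⟨i, _ | _⟩ <;> simp [bLetter]

theorem mk_cons_eq_bLetter_mul {ι : Type*} (p : ι × Bool) (L : List (ι × Bool)) :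
    mk (p :: L) = bLetter p * mk L := by
  rcases p with ⟨i, _ | _⟩ <;> simp [bLetter, of, invRev]

section

variable {ι κ : Type*} [Fintype ι] [DecidableEq ι] [DecidableEq κ]

/-- The maximal cancellation of the image of a letter with the image of a following letter:
`Sc` for a basis element and `Pc` for the inverse of one. -/
def letterSc (χ : FreeGroup ι →* FreeGroup κ) (p : ι × Bool) : ℕ :=
  cond p.2 (Sc χ p.1) (Pc χ p.1)

theorem cancel_le_letterSc (χ : FreeGroup ι →* FreeGroup κ) {p q : ι × Bool}
    (h : q ≠ (p.1, !p.2)) : cancel (χ (bLetter p)) (χ (bLetter q)) ≤ letterSc χ p := by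
  rcases p with ⟨i, _ | _⟩
  · have hq : (q.1, !q.2) ∈ Finset.univ.erase (i, false) := by
      rcases q with ⟨j, _ | _⟩ <;> simp_all
    rw [← cancel_inv_inv, ← map_inv, ← map_inv, bLetter_inv, bLetter_inv]
    exact Finset.le_sup (f := fun p => cancel (χ (bLetter p)) (χ (FreeGroup.of i))) hq
  · have hq : q ∈ Finset.univ.erase (i, false) := by simpa using h
    exact Finset.le_sup (f := fun p => cancel (χ (FreeGroup.of i)) (χ (bLetter p))) hq

theorem cancel_le_letterSc_inv (χ : FreeGroup ι →* FreeGroup κ) {p q : ι × Bool}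
    (h : q ≠ (p.1, !p.2)) :
    cancel (χ (bLetter p)) (χ (bLetter q)) ≤ letterSc χ (q.1, !q.2) := by
  rw [← cancel_inv_inv, ← map_inv, ← map_inv, bLetter_inv, bLetter_inv]
  apply cancel_le_letterSc
  intro h'
  apply h
  rcases p with ⟨i, _ | _⟩ <;> rcases q with ⟨j, _ | _⟩ <;> simp_all

theorem HasRemnant.letterSc_add_lt {χ : FreeGroup ι →* FreeGroup κ} (h : HasRemnant χ)
    (p : ι × Bool) : letterSc χ (p.1, !p.2) + letterSc χ p < norm (χ (bLetter p)) := by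
  rcases p with ⟨i, _ | _⟩
  · simpa [letterSc, bLetter, norm_inv_eq, add_comm] using h i
  · simpa [letterSc, bLetter] using h i

/-- The image of a reduced word begins with all of the image of its first letter but the part
which can cancel on the right. -/
theorem HasRemnant.norm_le_cancel_add {χ : FreeGroup ι →* FreeGroup κ} (h : HasRemnant χ)
    (p : ι × Bool) (L : List (ι × Bool)) (hL : IsReduced (p :: L)) :
    norm (χ (bLetter p)) ≤
      cancel (χ (bLetter p))⁻¹ (χ (mk (p :: L))) + letterSc χ p := by
  induction L generalizing p with
  | nil => simp [mk_cons_eq_bLetter_mul, ← one_eq_mk, cancel_inv_self]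
  | cons q L ih =>
    obtain ⟨hpq, hqL⟩ := isReduced_cons_cons.1 hL
    have hne : q ≠ (p.1, !p.2) := by
      rintro rfl
      simp at hpq
    have h1 := ih q hqL
    have h2 := h.letterSc_add_lt q
    have h3 := cancel_le_letterSc χ hne
    have h4 := cancel_le_letterSc_inv χ hne
    have h5 := min_cancel_le (χ (bLetter p)) (χ (bLetter q)) (χ (mk (q :: L)))
    have h6 : cancel (χ (mk (q :: L)))⁻¹ (χ (bLetter q)) =
        cancel (χ (bLetter q))⁻¹ (χ (mk (q :: L))) := by
      rw [← cancel_inv_inv, inv_inv]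
    have h7 := cancel_inv_mul_add_cancel (χ (bLetter p)) (χ (mk (q :: L)))
    rw [mk_cons_eq_bLetter_mul p, map_mul]
    omega

end

/-- Staecker's strong remnant criterion: let `χ = φ^v * ψ : G*G → H` (sending
`aᵢ ↦ v⁻¹(aᵢφ)v`, `aᵢ′ ↦ aᵢψ`). If `u ≠ v`, `χ` has remnant, and for every basis element
`a` of `G*G` the remnant of `a` does not fully cancel in the products `(aχ)(v⁻¹u)` and
`(u⁻¹v)(aχ)`, then `u` and `v` are not doubly-twisted conjugate. -/
theorem not_doubly_twisted_of_strong_remnant {n : ℕ} {κ : Type*} [Fintype κ] [DecidableEq κ]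
    (φ ψ : FreeGroup (Fin n) →* FreeGroup κ) (u v : FreeGroup κ) (huv : u ≠ v)
    (χ : FreeGroup (Fin n ⊕ Fin n) →* FreeGroup κ)
    (hχ : χ = FreeGroup.lift (Sum.elim (fun i => v⁻¹ * φ (FreeGroup.of i) * v)
        (fun i => ψ (FreeGroup.of i))))
    (hrem : HasRemnant χ)
    (h1 : ∀ a : Fin n ⊕ Fin n,
      cancel (χ (FreeGroup.of a)) (v⁻¹ * u) < FreeGroup.norm (χ (FreeGroup.of a)) - Pc χ a)
    (h2 : ∀ a : Fin n ⊕ Fin n,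
      cancel (u⁻¹ * v) (χ (FreeGroup.of a)) < FreeGroup.norm (χ (FreeGroup.of a)) - Sc χ a) :
    ¬ ∃ g : FreeGroup (Fin n), (φ g)⁻¹ * u * ψ g = v := by
  rintro ⟨g, hg⟩
  have hφ : χ (FreeGroup.map Sum.inl g) = v⁻¹ * φ g * v := by
    have : χ.comp (FreeGroup.map Sum.inl) = (MulAut.conj v⁻¹).toMonoidHom.comp φ := by
      ext i
      simp [hχ]
    simpa using DFunLike.congr_fun this g
  have hψ : χ (FreeGroup.map Sum.inr g) = ψ g := by
    have : χ.comp (FreeGroup.map Sum.inr) = ψ := by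
      ext i
      simp [hχ]
    exact DFunLike.congr_fun this g
  obtain ⟨w, hw⟩ : ∃ w, χ w = v⁻¹ * u := by
    refine ⟨FreeGroup.map Sum.inl g * (FreeGroup.map Sum.inr g)⁻¹, ?_⟩
    rw [map_mul, map_inv, hφ, hψ]
    nth_rewrite 2 [← hg]
    group
  obtain ⟨W, hred, hw⟩ : ∃ W, IsReduced W ∧ χ (mk W) = v⁻¹ * u :=
    ⟨w.toWord, isReduced_toWord, by rwa [mk_toWord]⟩
  rcases W with _ | ⟨⟨a, _ | _⟩, L⟩
  · rw [← one_eq_mk, map_one, eq_comm, inv_mul_eq_one] at hw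
    exact huv hw.symm
  · have h := hrem.norm_le_cancel_add _ L hred
    rw [hw] at h
    simp only [bLetter, letterSc, cond_false, map_inv, inv_inv, norm_inv_eq] at h
    have := h1 a
    omega
  · have h := hrem.norm_le_cancel_add _ L hred
    rw [hw, ← cancel_inv_inv] at h
    simp only [bLetter, letterSc, cond_true, inv_inv, mul_inv_rev] at h
    have := h2 a
    omega
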